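/- Let all agents have matroid-rank valuations, let X = (X_1,…,X_n) be a non-redundant allocation, and let A = (A_1,…,A_n) be a Pareto-optimal non-redundant allocation such that there exists an agent h ∈ H(X, A). Then there exists an agent ℓ ∈ L(X, A) together with a simple directed path P = (g_k, g_{k−1}, …, g_2, g_1) in the exchange graph G(X) such that: (1) the source vertex satisfies g_k ∈ A_ℓ ∩ F_ℓ(X_ℓ) and the sink vertex satisfies g_1 ∈ X_h; and (2) there is a non-redundant allocation B with |B_ℓ| = |A_ℓ| − 1, |B_h| = |A_h| + 1, and |B_k| = |A_k| for all k ∈ N ∖ {ℓ, h}. -/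

import Mathlib

open Finset

/-- `v` is a matroid-rank (binary submodular) valuation on the ground set `M`:
binary marginal gains, monotone, submodular, and normalized. -/
def MatroidRank {γ : Type} [DecidableEq γ] (M : Finset γ) (v : Finset γ → ℕ) : Prop :=
  (∀ S ⊆ M, ∀ g ∈ M, g ∉ S → v (insert g S) = v S ∨ v (insert g S) = v S + 1) ∧
  (∀ S T : Finset γ, S ⊆ T → T ⊆ M → v S ≤ v T) ∧
  (∀ S T : Finset γ, S ⊆ T → T ⊆ M → ∀ g ∈ M, g ∉ T →
    v (insert g T) + v S ≤ v (insert g S) + v T) ∧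
  v ∅ = 0

/-- An allocation of (some of) the goods in `M` to `n` agents: pairwise disjoint bundles. -/
def IsAlloc {γ : Type} (n : ℕ) (M : Finset γ) (A : Fin n → Finset γ) : Prop :=
  (∀ i, A i ⊆ M) ∧ ∀ i j : Fin n, i ≠ j → Disjoint (A i) (A j)

/-- Non-redundancy: every agent's utility equals her bundle size. -/
def NonRedundant {γ : Type} (n : ℕ) (v : Fin n → Finset γ → ℕ) (A : Fin n → Finset γ) : Prop :=
  ∀ i, v i (A i) = (A i).card

/-- Pareto-optimality of an allocation. -/
def ParetoOptimal {γ : Type} (n : ℕ) (M : Finset γ) (v : Fin n → Finset γ → ℕ)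
    (A : Fin n → Finset γ) : Prop :=
  ¬ ∃ B : Fin n → Finset γ, IsAlloc n M B ∧ (∀ i, v i (A i) ≤ v i (B i)) ∧
      ∃ i, v i (A i) < v i (B i)

/-- The edge relation of the exchange graph of allocation `A` (vertex set `M`). -/
def ExEdge {γ : Type} [DecidableEq γ] (n : ℕ) (M : Finset γ) (v : Fin n → Finset γ → ℕ)
    (A : Fin n → Finset γ) (a b : γ) : Prop :=
  a ∈ M ∧ b ∈ M ∧ ∃ i, a ∈ A i ∧ b ∉ A i ∧ v i ((insert b (A i)).erase a) = v i (A i)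

/-- `FSet M v B g` : good `g ∈ M` lies outside `B` and adds marginal value `1` to `B`. -/
def FSet {γ : Type} [DecidableEq γ] (M : Finset γ) (v : Finset γ → ℕ) (B : Finset γ)
    (g : γ) : Prop :=
  g ∈ M ∧ g ∉ B ∧ v (insert g B) = v B + 1

/-- Path augmentation `B △ P`: for each consecutive pair `(gⱼ, gⱼ₊₁)` of the path `P`
with `gⱼ ∈ B`, remove `gⱼ` and add `gⱼ₊₁`. -/
def augmentPath {γ : Type} [DecidableEq γ] (B : Finset γ) (P : List γ) : Finset γ :=
  (B \ (((P.zip P.tail).filter fun p => p.1 ∈ B).map Prod.fst).toFinset) ∪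
    (((P.zip P.tail).filter fun p => p.1 ∈ B).map Prod.snd).toFinset

/-- The weighted welfare `∑ i, wᵢ · f(vᵢ(Aᵢ))`. -/
noncomputable def Welfare {γ : Type} (n : ℕ) (w : Fin n → ℝ) (v : Fin n → Finset γ → ℕ)
    (f : ℕ → EReal) (A : Fin n → Finset γ) : EReal :=
  ∑ i, (w i : EReal) * f (v i (A i))

/-- The set of agents receiving positive utility. -/
def PosAgents {γ : Type} (n : ℕ) (v : Fin n → Finset γ → ℕ) (A : Fin n → Finset γ) :
    Finset (Fin n) :=
  Finset.univ.filter fun i => 0 < v i (A i)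

/-- The weighted welfare restricted to the positively-served agents. -/
noncomputable def RWelfare {γ : Type} (n : ℕ) (w : Fin n → ℝ) (v : Fin n → Finset γ → ℕ)
    (f : ℕ → EReal) (A : Fin n → Finset γ) : EReal :=
  ∑ i ∈ PosAgents n v A, (w i : EReal) * f (v i (A i))

/-- `S` is lexicographically preferred to `T` (favoring lower indices), strictly. -/
def LexLt {n : ℕ} (S T : Finset (Fin n)) : Prop :=
  ∃ i, i ∈ S ∧ i ∉ T ∧ ∀ j, j < i → (j ∈ S ↔ j ∈ T)

/-- `S` is lexicographically weakly preferred to `T` (favoring lower indices). -/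
def LexLE {n : ℕ} (S T : Finset (Fin n)) : Prop := S = T ∨ LexLt S T

/-- `A` is an `R_f` allocation: it maximizes the weighted welfare; if the maximum welfare
is `-∞`, it first maximizes the number of positively-served agents (breaking ties between
the sets of positively-served agents lexicographically in favor of lower indices), and then
maximizes the weighted welfare over the positively-served agents. -/
def IsRf {γ : Type} (n : ℕ) (M : Finset γ) (w : Fin n → ℝ) (v : Fin n → Finset γ → ℕ)
    (f : ℕ → EReal) (A : Fin n → Finset γ) : Prop :=
  IsAlloc n M A ∧
  ((∃ B, IsAlloc n M B ∧ Welfare n w v f B ≠ ⊥) →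
    ∀ B, IsAlloc n M B → Welfare n w v f B ≤ Welfare n w v f A) ∧
  ((∀ B, IsAlloc n M B → Welfare n w v f B = ⊥) →
    ∀ B, IsAlloc n M B →
      ((PosAgents n v B).card < (PosAgents n v A).card ∨
        ((PosAgents n v B).card = (PosAgents n v A).card ∧
          LexLE (PosAgents n v A) (PosAgents n v B))) ∧
      (PosAgents n v B = PosAgents n v A → RWelfare n w v f B ≤ RWelfare n w v f A))

/-- Strict lexicographic order on utility vectors. -/
def VecLexLt (n : ℕ) (u u' : Fin n → ℕ) : Prop :=
  ∃ i, u i < u' i ∧ ∀ j, j < i → u j = u' j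

/-- `A` is an `R^tie_f` allocation: an `R_f` allocation that is lexicographically dominating
within the set of `R_f` allocations and non-redundant. -/
def IsRfTie {γ : Type} (n : ℕ) (M : Finset γ) (w : Fin n → ℝ) (v : Fin n → Finset γ → ℕ)
    (f : ℕ → EReal) (A : Fin n → Finset γ) : Prop :=
  IsRf n M w v f A ∧
  (∀ B, IsRf n M w v f B → ¬ VecLexLt n (fun i => v i (A i)) (fun i => v i (B i))) ∧
  NonRedundant n v A

theorem tp_simple_path {α : Type} {R : α → α → Prop} {a b : α}
    (hab : Relation.ReflTransGen R a b) :
    ∃ l : List α, (a :: l).Nodup ∧ (a :: l).IsChain R ∧ (a :: l).getLast? = some b := by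
  induction hab using Relation.ReflTransGen.head_induction_on with
  | refl => exact ⟨[], by simp, by simp, by simp⟩
  | head hac _ ih =>
    rename_i a c _
    obtain ⟨l, h1, h2, h3⟩ := ih
    by_cases hmem : a ∈ c :: l
    · obtain ⟨s, t, hst⟩ := List.append_of_mem hmem
      rw [hst] at h1 h2 h3
      refine ⟨t, (List.nodup_append.1 h1).2.1, (List.isChain_append.1 h2).2.1, ?_⟩
      simpa [List.getLast?_append] using h3
    · refine ⟨c :: l, List.nodup_cons.2 ⟨hmem, h1⟩, List.isChain_cons_cons.2 ⟨hac, h2⟩, ?_⟩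
      rw [List.getLast?_cons_cons]; exact h3

section
variable {γ : Type} [DecidableEq γ] {M : Finset γ} {v : Finset γ → ℕ}

theorem tp_union_bound (hv : MatroidRank M v) (S T : Finset γ) (hS : S ⊆ M) (hT : T ⊆ M) :
    v (S ∪ T) ≤ v S + T.card := by
  induction T using Finset.induction_on with
  | empty => simp
  | insert a T ha ih =>
    have haM : a ∈ M := hT (mem_insert_self _ _)
    have hTM : T ⊆ M := (subset_insert _ _).trans hT
    have := ih hTM
    rw [card_insert_of_notMem ha, union_insert]
    by_cases haU : a ∈ S ∪ T
    · rw [insert_eq_of_mem haU]; omega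
    · rcases hv.1 (S ∪ T) (union_subset hS hTM) a haM haU with h | h <;> omega

theorem tp_le_card (hv : MatroidRank M v) (T : Finset γ) (hT : T ⊆ M) : v T ≤ T.card := by
  have := tp_union_bound hv ∅ T (empty_subset _) hT
  rw [empty_union, hv.2.2.2] at this; omega

theorem tp_indep_subset (hv : MatroidRank M v) (S T : Finset γ) (hT : T ⊆ M) (hST : S ⊆ T)
    (h : v T = T.card) : v S = S.card := by
  have h1 := tp_union_bound hv S (T \ S) (hST.trans hT) (sdiff_subset.trans hT)
  rw [union_sdiff_of_subset hST] at h1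
  have h2 := tp_le_card hv S (hST.trans hT)
  have h3 := card_sdiff_add_card_eq_card hST
  omega

theorem tp_span (hv : MatroidRank M v) (S T : Finset γ) (hS : S ⊆ M) (hT : T ⊆ M)
    (h : ∀ x ∈ T, v (insert x S) = v S) : v (S ∪ T) = v S := by
  induction T using Finset.induction_on with
  | empty => simp
  | insert a T ha ih =>
    have haM : a ∈ M := hT (mem_insert_self _ _)
    have hTM : T ⊆ M := (subset_insert _ _).trans hT
    have h1 := ih hTM (fun x hx => h x (mem_insert_of_mem hx))
    have h2 := h a (mem_insert_self _ _)
    rw [union_insert]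
    by_cases haU : a ∈ S ∪ T
    · rw [insert_eq_of_mem haU]; omega
    · have h3 := hv.2.2.1 S (S ∪ T) subset_union_left (union_subset hS hTM) a haM haU
      rcases hv.1 (S ∪ T) (union_subset hS hTM) a haM haU with h | h <;> omega

theorem tp_ne_succ (hv : MatroidRank M v) (S : Finset γ) (hS : S ⊆ M) (x : γ) (hx : x ∈ M)
    (h : v (insert x S) ≠ v S) : x ∉ S ∧ v (insert x S) = v S + 1 := by
  have hxS : x ∉ S := fun hxS => h (by rw [insert_eq_of_mem hxS])
  exact ⟨hxS, (hv.1 S hS x hx hxS).resolve_left h⟩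

theorem tp_augment (hv : MatroidRank M v) (I J : Finset γ) (hI : I ⊆ M) (hJ : J ⊆ M)
    (h : v I < v J) : ∃ x ∈ J, x ∉ I ∧ v (insert x I) = v I + 1 := by
  by_contra hcon
  have := tp_span hv I J hI hJ (fun x hx => by
    by_contra hne
    exact hcon ⟨x, hx, tp_ne_succ hv I hI x (hJ hx) hne⟩)
  have h2 := hv.2.1 J (I ∪ J) subset_union_right (union_subset hI hJ)
  omega

theorem tp_symm (hv : MatroidRank M v) (I J : Finset γ) (hI : I ⊆ M) (hJ : J ⊆ M) (g : γ)
    (hg : g ∈ M) (hgI : g ∉ I) (hgJ : g ∉ J) (hIi : v I = I.card)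
    (hdep : v (insert g I) = v I) (hJg : v (insert g J) = v J + 1) :
    ∃ x ∈ I, x ∉ J ∧ v (insert x J) = v J + 1 ∧ v ((insert g I).erase x) = v I := by
  obtain ⟨T, hT, hmin⟩ := Finset.exists_min_image
    (I.powerset.filter fun T => v (insert g T) = v T) Finset.card
    ⟨I, by simp [hdep]⟩
  simp only [mem_filter, mem_powerset] at hT hmin
  obtain ⟨hTI, hTg⟩ := hT
  have hTM := hTI.trans hI
  have hgT : g ∉ T := fun h => hgI (hTI h)
  have hex : ∃ x ∈ T, v (insert x J) ≠ v J := by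
    by_contra hcon
    push Not at hcon
    have h1 := tp_span hv J T hJ hTM hcon
    have h2 := hv.2.2.1 T (J ∪ T) subset_union_right (union_subset hJ hTM) g hg
      (by simp [hgJ, hgT])
    have h3 := hv.2.1 (insert g J) (insert g (J ∪ T)) (insert_subset_insert _ subset_union_left)
      (insert_subset hg (union_subset hJ hTM))
    omega
  obtain ⟨x, hxT, hx⟩ := hex
  have hxM := hTM hxT
  have hxI := hTI hxT
  obtain ⟨hxJ, hx1⟩ := tp_ne_succ hv J hJ x hxM hx
  refine ⟨x, hxI, hxJ, hx1, ?_⟩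
  have hgx : g ≠ x := fun h => hgI (h ▸ hxI)
  have hne : v (insert g (T.erase x)) ≠ v (T.erase x) := fun h => by
    have := hmin (T.erase x) ⟨(erase_subset _ _).trans hTI, h⟩
    have h2 := card_erase_lt_of_mem hxT
    omega
  have h1 := (tp_ne_succ hv _ ((erase_subset _ _).trans hTM) g hg hne).2
  have hTi := tp_indep_subset hv T I hI hTI hIi
  have hTei := tp_indep_subset hv (T.erase x) I hI ((erase_subset _ _).trans hTI) hIi
  have hcard := card_erase_add_one hxT
  have hsub : insert g (T.erase x) ⊆ insert g (I.erase x) :=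
    insert_subset_insert _ (erase_subset_erase _ hTI)
  have hM' : insert g (I.erase x) ⊆ M := insert_subset hg ((erase_subset _ _).trans hI)
  have h2 := hv.2.2.1 _ _ hsub hM' x hxM (by simp [hgx.symm])
  rw [Finset.insert_comm x g (I.erase x), insert_erase hxI, Finset.insert_comm x g (T.erase x), insert_erase hxT] at h2
  have h3 := hv.2.1 (insert g (I.erase x)) (insert g I)
    (insert_subset_insert _ (erase_subset _ _)) (insert_subset hg hI)
  rw [erase_insert_of_ne hgx]
  omega

end

section
variable {γ : Type} [DecidableEq γ] {n : ℕ}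

/-- The state of the exchange process before agent `i` receives a good. -/
structure TPState (M : Finset γ) (v : Fin n → Finset γ → ℕ) (X A : Fin n → Finset γ)
    (h : Fin n) (D : Fin n → Finset γ) (i : Fin n) : Prop where
  alloc : IsAlloc n M D
  nonred : NonRedundant n v D
  size : ∀ k, (D k).card + (if k = i then 1 else 0) = (A k).card + (if k = h then 1 else 0)
  orig : ∀ k, ∀ g ∈ D k, g ∉ X k → g ∈ A k

theorem tp_transfer {M : Finset γ} {v : Fin n → Finset γ → ℕ} (hv : ∀ i, MatroidRank M (v i))
    {X A : Fin n → Finset γ} (hX : IsAlloc n M X) (hAnr : NonRedundant n v A)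
    (hApo : ParetoOptimal n M v A) {h : Fin n} {D : Fin n → Finset γ} {i : Fin n}
    (hD : TPState M v X A h D i) (g : γ) (hgX : g ∈ X i) (hgD : g ∉ D i)
    (hgv : v i (insert g (D i)) = v i (D i) + 1) :
    ∃ (D' : Fin n → Finset γ) (j : Fin n), TPState M v X A h D' j ∧ g ∈ A j ∧ g ∉ X j ∧
      g ∉ D' j ∧ v j (insert g (D' j)) = v j (D' j) + 1 ∧
      ∑ k, (X k \ D' k).card < ∑ k, (X k \ D k).card := by
  have hgM : g ∈ M := hX.1 i hgX
  have hcardi : (insert g (D i)).card = (D i).card + 1 := card_insert_of_notMem hgD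
  by_cases hown : ∃ j, g ∈ D j
  · obtain ⟨j, hj⟩ := hown
    have hij : j ≠ i := fun e => hgD (e ▸ hj)
    have hgXj : g ∉ X j := fun hg => Finset.disjoint_left.1 (hX.2 j i hij) hg hgX
    set D' : Fin n → Finset γ := fun k => if k = i then insert g (D i) else (D k).erase g with hD'
    have hi' : D' i = insert g (D i) := by simp [hD']
    have hne' : ∀ k, k ≠ i → D' k = (D k).erase g := fun k hk => by simp [hD', hk]
    have hoth : ∀ k, k ≠ i → k ≠ j → D' k = D k := fun k hk hkj => by
      rw [hne' k hk]
      exact erase_eq_of_notMem fun hg => Finset.disjoint_left.1 (hD.alloc.2 k j hkj) hg hj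
    have hcardj : (D' j).card + 1 = (D j).card := by
      rw [hne' j hij]; exact card_erase_add_one hj
    have hnr : NonRedundant n v D' := fun k => by
      by_cases hk : k = i
      · subst hk; rw [hi', hgv, hcardi, hD.nonred]
      · rw [hne' k hk]
        exact tp_indep_subset (hv k) _ (D k) (hD.alloc.1 k) (erase_subset _ _) (hD.nonred k)
    refine ⟨D', j, ⟨⟨?_, ?_⟩, hnr, ?_, ?_⟩, hD.orig j g hj hgXj, hgXj, ?_, ?_, ?_⟩
    · intro k
      by_cases hk : k = i
      · subst hk; rw [hi']; exact insert_subset hgM (hD.alloc.1 k)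
      · rw [hne' k hk]; exact (erase_subset _ _).trans (hD.alloc.1 k)
    · have key : ∀ b, b ≠ i → Disjoint (D' i) (D' b) := fun b hb => by
        rw [hi', hne' b hb, Finset.disjoint_insert_left]
        exact ⟨notMem_erase _ _, (hD.alloc.2 i b hb.symm).mono_right (erase_subset _ _)⟩
      intro a b hab
      by_cases ha : a = i
      · subst ha; exact key b hab.symm
      · by_cases hb : b = i
        · subst hb; exact (key a ha).symm
        · rw [hne' a ha, hne' b hb]
          exact (hD.alloc.2 a b hab).mono (erase_subset _ _) (erase_subset _ _)
    · intro k
      have hs := hD.size k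
      by_cases hk : k = i
      · subst hk
        rw [hi', hcardi, if_neg hij.symm]
        simpa using hs
      · by_cases hkj : k = j
        · subst hkj
          rw [if_pos rfl, hcardj]
          simpa [hk] using hs
        · rw [hoth k hk hkj]
          simpa [hk, hkj] using hs
    · intro k x hx hxX
      by_cases hk : k = i
      · subst hk
        rw [hi', mem_insert] at hx
        rcases hx with rfl | hx
        · exact absurd hgX hxX
        · exact hD.orig k x hx hxX
      · rw [hne' k hk] at hx
        exact hD.orig k x (mem_of_mem_erase hx) hxX
    · rw [hne' j hij]; exact notMem_erase _ _
    · rw [hnr j, hcardj, hne' j hij, insert_erase hj, hD.nonred]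
    · refine Finset.sum_lt_sum (fun k _ => ?_) ⟨i, mem_univ _, ?_⟩
      · apply card_le_card
        intro x hx
        rw [mem_sdiff] at hx ⊢
        refine ⟨hx.1, fun hxD => hx.2 ?_⟩
        by_cases hk : k = i
        · subst hk; rw [hi']; exact mem_insert_of_mem hxD
        · rw [hne' k hk]
          refine mem_erase.2 ⟨fun e => ?_, hxD⟩
          subst e
          exact Finset.disjoint_left.1 (hX.2 k i hk) hx.1 hgX
      · apply card_lt_card
        rw [hi', Finset.ssubset_iff_of_subset (sdiff_subset_sdiff subset_rfl (subset_insert _ _))]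
        exact ⟨g, by simp [hgX, hgD], by simp⟩
  · exfalso
    push Not at hown
    set D' : Fin n → Finset γ := fun k => if k = i then insert g (D i) else D k with hD'
    have hi' : D' i = insert g (D i) := by simp [hD']
    have hne' : ∀ k, k ≠ i → D' k = D k := fun k hk => by simp [hD', hk]
    have hval : ∀ k, v k (D' k) = v k (A k) + (if k = h then 1 else 0) := fun k => by
      have hs := hD.size k
      rw [hAnr k, ← hs]
      by_cases hk : k = i
      · subst hk; rw [hi', hgv, hD.nonred]; simp
      · rw [hne' k hk, hD.nonred]; simp [hk]
    refine hApo ⟨D', ⟨?_, ?_⟩, fun k => by rw [hval k]; omega, h, by rw [hval h]; simp⟩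
    · intro k
      by_cases hk : k = i
      · subst hk; rw [hi']; exact insert_subset hgM (hD.alloc.1 k)
      · rw [hne' k hk]; exact hD.alloc.1 k
    · have key : ∀ b, b ≠ i → Disjoint (D' i) (D' b) := fun b hb => by
        rw [hi', hne' b hb, Finset.disjoint_insert_left]
        exact ⟨hown b, hD.alloc.2 i b hb.symm⟩
      intro a b hab
      by_cases ha : a = i
      · subst ha; exact key b hab.symm
      · by_cases hb : b = i
        · subst hb; exact (key a ha).symm
        · rw [hne' a ha, hne' b hb]
          exact hD.alloc.2 a b hab

theorem tp_main {M : Finset γ} {v : Fin n → Finset γ → ℕ} (hv : ∀ i, MatroidRank M (v i))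
    {X A : Fin n → Finset γ} (hX : IsAlloc n M X) (hXnr : NonRedundant n v X)
    (hAnr : NonRedundant n v A)
    (hApo : ParetoOptimal n M v A) {h : Fin n} (hh : (A h).card < (X h).card) (g1 : γ) :
    ∀ (m : ℕ) (D : Fin n → Finset γ) (i : Fin n) (g : γ), TPState M v X A h D i →
      ∑ k, (X k \ D k).card ≤ m → g ∈ M → g ∈ A i → g ∉ X i → g ∉ D i →
      v i (insert g (D i)) = v i (D i) + 1 → Relation.ReflTransGen (ExEdge n M v X) g g1 →
      ∃ (ℓ : Fin n) (gk : γ) (B : Fin n → Finset γ), (X ℓ).card < (A ℓ).card ∧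
        TPState M v X A h B ℓ ∧ gk ∈ A ℓ ∧ FSet M (v ℓ) (X ℓ) gk ∧
        Relation.ReflTransGen (ExEdge n M v X) gk g1 := by
  intro m
  induction m with
  | zero =>
    intro D i g hD hm hgM hgA hgX hgD hgv hpath
    by_cases hfin : (X i).card < (A i).card ∧ FSet M (v i) (X i) g
    · exact ⟨i, g, D, hfin.1, hD, hgA, hfin.2, hpath⟩
    exfalso
    have hsub : ∀ k, X k ⊆ D k := by
      simpa [Finset.sum_eq_zero_iff, Finset.sdiff_eq_empty_iff_subset] using hm
    have h1 := tp_indep_subset (hv i) (insert g (X i)) (insert g (D i))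
      (insert_subset hgM (hD.alloc.1 i)) (insert_subset_insert _ (hsub i))
      (by rw [hgv, card_insert_of_notMem hgD, hD.nonred])
    rw [card_insert_of_notMem hgX, ← hXnr i] at h1
    refine hfin ⟨?_, hgM, hgX, h1⟩
    have hs := hD.size i
    have hc := card_le_card (hsub i)
    have hsh := hD.size h
    have hch := card_le_card (hsub h)
    by_cases hih : i = h
    · subst hih; simp at hs; omega
    · simp [hih] at hs; omega
  | succ m ih =>
    intro D i g hD hm hgM hgA hgX hgD hgv hpath
    by_cases hfin : (X i).card < (A i).card ∧ FSet M (v i) (X i) g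
    · exact ⟨i, g, D, hfin.1, hD, hgA, hfin.2, hpath⟩
    have hstep : ∃ x ∈ X i, x ∉ D i ∧ v i (insert x (D i)) = v i (D i) + 1 ∧
        v i ((insert g (X i)).erase x) = v i (X i) := by
      by_cases hdep : v i (insert g (X i)) = v i (X i)
      · exact tp_symm (hv i) (X i) (D i) (hX.1 i) (hD.alloc.1 i) g hgM hgX hgD (hXnr i) hdep hgv
      · obtain ⟨-, hind⟩ := tp_ne_succ (hv i) (X i) (hX.1 i) g hgM hdep
        have hle : (A i).card ≤ (X i).card := by
          by_contra hlt
          exact hfin ⟨by omega, hgM, hgX, hind⟩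
        have hs := hD.size i
        have hlt : v i (D i) < v i (X i) := by
          rw [hD.nonred i, hXnr i]
          by_cases hih : i = h
          · subst hih; simp at hs; omega
          · simp [hih] at hs; omega
        obtain ⟨x, hxX, hxD, hxv⟩ := tp_augment (hv i) (D i) (X i) (hD.alloc.1 i) (hX.1 i) hlt
        refine ⟨x, hxX, hxD, hxv, ?_⟩
        rw [tp_indep_subset (hv i) ((insert g (X i)).erase x) (insert g (X i))
          (insert_subset hgM (hX.1 i)) (erase_subset _ _)
          (by rw [hind, card_insert_of_notMem hgX, hXnr]),
          card_erase_of_mem (mem_insert_of_mem hxX), card_insert_of_notMem hgX, hXnr]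
        rfl
    obtain ⟨x, hxX, hxD, hxv, hxe⟩ := hstep
    obtain ⟨D', j, hD', hxA, hxXj, hxD', hxv', hlt⟩ :=
      tp_transfer hv hX hAnr hApo hD x hxX hxD hxv
    have hxM := hX.1 i hxX
    exact ih D' j x hD' (by omega) hxM hxA hxXj hxD' hxv'
      (Relation.ReflTransGen.head ⟨hxM, hgM, i, hxX, hgX, hxe⟩ hpath)

end

/-- Given a non-redundant allocation `X` and a Pareto-optimal non-redundant allocation `A`
with an agent `h ∈ H(X, A)`, there is an agent `ℓ ∈ L(X, A)` together with a simple directed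
path in the exchange graph `G(X)` from a good in `A_ℓ ∩ F_ℓ(X_ℓ)` to a good in `X_h`, and from
`A` one can move a unit of utility from `ℓ` to `h` via a non-redundant allocation. -/
theorem transferPathLemma {γ : Type} [DecidableEq γ] {n : ℕ} (M : Finset γ)
    (v : Fin n → Finset γ → ℕ) (hv : ∀ i, MatroidRank M (v i))
    (X A : Fin n → Finset γ)
    (hX : IsAlloc n M X) (hXnr : NonRedundant n v X)
    (hA : IsAlloc n M A) (hAnr : NonRedundant n v A) (hApo : ParetoOptimal n M v A)
    (h : Fin n) (hh : (A h).card < (X h).card) :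
    ∃ ℓ : Fin n, (X ℓ).card < (A ℓ).card ∧
      (∃ (P : List γ) (gk g1 : γ), P ≠ [] ∧ P.Nodup ∧ P.Chain' (ExEdge n M v X) ∧
        P.head? = some gk ∧ P.getLast? = some g1 ∧
        gk ∈ A ℓ ∧ FSet M (v ℓ) (X ℓ) gk ∧ g1 ∈ X h) ∧
      (∃ B : Fin n → Finset γ, IsAlloc n M B ∧ NonRedundant n v B ∧
        (B ℓ).card + 1 = (A ℓ).card ∧ (B h).card = (A h).card + 1 ∧
        ∀ k : Fin n, k ≠ ℓ → k ≠ h → (B k).card = (A k).card) := by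
  have h0 : TPState M v X A h A h := ⟨hA, hAnr, fun _ => rfl, fun _ _ hg _ => hg⟩
  obtain ⟨g1, hg1X, hg1A, hg1v⟩ := tp_augment (hv h) (A h) (X h) (hA.1 h) (hX.1 h)
    (by rw [hAnr, hXnr]; exact hh)
  obtain ⟨D, j, hD, h1, h2, h3, h4, -⟩ := tp_transfer hv hX hAnr hApo h0 g1 hg1X hg1A hg1v
  obtain ⟨ℓ, gk, B, hℓ, hB, hgA, hgF, hpath⟩ := tp_main hv hX hXnr hAnr hApo hh g1 _ D j g1 hD
    le_rfl (hX.1 h hg1X) h1 h2 h3 h4 Relation.ReflTransGen.refl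
  have hℓh : ℓ ≠ h := fun e => by subst e; omega
  obtain ⟨l, hl1, hl2, hl3⟩ := tp_simple_path hpath
  refine ⟨ℓ, hℓ, ⟨gk :: l, gk, g1, by simp, hl1, hl2, rfl, hl3, hgA, hgF, hg1X⟩,
    B, hB.alloc, hB.nonred, ?_, ?_, fun k hk hkh => ?_⟩
  · simpa [hℓh] using hB.size ℓ
  · simpa [hℓh.symm] using hB.size h
  · simpa [hk, hkh] using hB.size k
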